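/- Fix e ≥ 1. The function Λ(x_1,…,x_e, y_1,…,y_e) = −(2^{e+1}/3^e) ∏_{j=1}^e x_j + 2 ∏_{j=1}^e Ω(1/x_j, 0) + ∏_{j=1}^e Ω(1/x_j, 1 + 2y_j/x_j), defined for x_1,…,x_e > 0 and y_1,…,y_e ∈ ℝ, attains a global minimum, and (x_1,…,x_e, y_1,…,y_e) is a global minimizer if and only if x_1 = ⋯ = x_e = b_e and y_j ∈ {(1 − 2b_e)/4 + n/2 : n ∈ ℤ} for each j ∈ {1,…,e}, where b_e is the unique root in the interval (1, 1 + 3^{e+1}/2^{2e+3}) of the polynomial x^{3e} − (3^e/2^{e−2})(x−1)(3x^2 − 4x + 2)^{e−1} − (3^e/2^{2e})(2x−1)^{2e−1} (in particular, this polynomial has exactly one root in that interval). -/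

import Mathlib

/-- `Omega x y = ∑_{n ∈ ℤ} max(0, 1 - |x n - y|)^2`. -/
noncomputable def Omega (x y : ℝ) : ℝ := ∑' n : ℤ, max 0 (1 - |x * (n : ℝ) - y|) ^ 2

/-- The limiting value of `(‖f‖₄/‖f‖₂)⁴` for a size- and translation-stable family of
`e`-variable quadratic multiplicative character polynomials with limiting sizes `x` and
limiting translations `y`. -/
noncomputable def Lam (e : ℕ) (x y : Fin e → ℝ) : ℝ :=
  -((2 : ℝ) ^ (e + 1) / 3 ^ e) * ∏ j, x j + 2 * ∏ j, Omega (1 / x j) 0 +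
    ∏ j, Omega (1 / x j) (1 + 2 * y j / x j)

/-! ### Bounds for `Omega` -/

theorem summable_Omega {h : ℝ} (hh : 0 < h) (y : ℝ) :
    Summable fun n : ℤ => max 0 (1 - |h * (n : ℝ) - y|) ^ 2 := by
  refine summable_of_ne_finset_zero (s := Finset.Icc ⌊(y - 1) / h⌋ ⌈(y + 1) / h⌉) fun n hn => ?_
  have key : 1 - |h * (n : ℝ) - y| ≤ 0 := by
    rw [Finset.mem_Icc, not_and_or, not_le, not_le] at hn
    rcases hn with hn | hn
    · have h1 : (n : ℝ) < (y - 1) / h :=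
        lt_of_lt_of_le (by exact_mod_cast hn) (Int.floor_le _)
      rw [lt_div_iff₀ hh] at h1
      have := neg_abs_le (h * (n : ℝ) - y)
      linarith
    · have h1 : (y + 1) / h < (n : ℝ) :=
        lt_of_le_of_lt (Int.le_ceil _) (by exact_mod_cast hn)
      rw [div_lt_iff₀ hh] at h1
      have := le_abs_self (h * (n : ℝ) - y)
      linarith
  rw [max_eq_left key]
  norm_num

theorem sum_le_Omega {h : ℝ} (hh : 0 < h) (y : ℝ) (s : Finset ℤ) :
    ∑ n ∈ s, max 0 (1 - |h * (n : ℝ) - y|) ^ 2 ≤ Omega h y :=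
  (summable_Omega hh y).sum_le_tsum s fun _ _ => sq_nonneg _

theorem Omega_nonneg (h y : ℝ) : 0 ≤ Omega h y :=
  tsum_nonneg fun _ => sq_nonneg _

theorem one_le_Omega_zero {h : ℝ} (hh : 0 < h) : 1 ≤ Omega h 0 := by
  simpa using sum_le_Omega hh 0 {0}

theorem one_sub_sq_le_Omega_zero {h : ℝ} (hh : 0 < h) (h1 : h ≤ 1) :
    1 + 2 * (1 - h) ^ 2 ≤ Omega h 0 := by
  have := sum_le_Omega hh 0 {-1, 0, 1}
  have e1 : max 0 (1 - h) = 1 - h := max_eq_right (by linarith)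
  simp [abs_of_pos hh, e1] at this
  linarith

theorem Omega_zero_eq {h : ℝ} (h2 : 1 / 2 ≤ h) (h1 : h ≤ 1) :
    Omega h 0 = 1 + 2 * (1 - h) ^ 2 := by
  have hh : 0 < h := by linarith
  have e1 : max 0 (1 - h) = 1 - h := max_eq_right (by linarith)
  rw [Omega, tsum_eq_sum (s := {-1, 0, 1})]
  · simp [abs_of_pos hh, e1]
    ring
  · intro n hn
    simp only [Finset.mem_insert, Finset.mem_singleton, not_or] at hn
    have hn2 : (2 : ℝ) ≤ |(n : ℝ)| := by
      have : (2 : ℤ) ≤ |n| := by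
        rcases abs_cases n with ⟨ha, _⟩ | ⟨ha, _⟩ <;> omega
      exact_mod_cast this
    have : 1 - |h * (n : ℝ) - 0| ≤ 0 := by
      rw [sub_zero, abs_mul, abs_of_pos hh]
      nlinarith
    rw [max_eq_left this]
    norm_num

/-- The two points nearest to `y` from either side. -/
theorem two_terms_le_Omega {h : ℝ} (hh : 0 < h) (y : ℝ) (N : ℤ) (h0 : 0 ≤ h * N - y)
    (h1 : h * N - y ≤ h) :
    max 0 (1 - (h * N - y)) ^ 2 + max 0 (1 - (h - (h * N - y))) ^ 2 ≤ Omega h y := by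
  have := sum_le_Omega hh y {N, N - 1}
  rw [Finset.sum_pair (by omega)] at this
  push_cast at this
  rw [abs_of_nonneg h0, abs_of_nonpos (by linarith : h * ((N : ℝ) - 1) - y ≤ 0)] at this
  convert this using 4
  ring

theorem exists_int_mul_sub_mem {h : ℝ} (hh : 0 < h) (y : ℝ) :
    ∃ N : ℤ, 0 ≤ h * N - y ∧ h * N - y ≤ h := by
  refine ⟨⌈y / h⌉, ?_, ?_⟩
  · have := Int.le_ceil (y / h)
    rw [div_le_iff₀ hh] at this
    linarith
  · have := (Int.ceil_lt_add_one (y / h)).le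
    have h2 : y / h * h = y := div_mul_cancel₀ _ hh.ne'
    nlinarith

theorem le_Omega_of_le_two {h : ℝ} (hh : 0 < h) (h2 : h ≤ 2) (y : ℝ) :
    2 * (1 - h / 2) ^ 2 ≤ Omega h y := by
  obtain ⟨N, h0, h1⟩ := exists_int_mul_sub_mem hh y
  refine le_trans ?_ (two_terms_le_Omega hh y N h0 h1)
  set τ := h * N - y
  have := le_max_right 0 (1 - τ)
  have := le_max_right 0 (1 - (h - τ))
  have hs : 2 - h ≤ max 0 (1 - τ) + max 0 (1 - (h - τ)) := by linarith
  nlinarith [sq_nonneg (max 0 (1 - τ) - max 0 (1 - (h - τ)))]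

theorem exists_of_Omega_eq {h : ℝ} (hh : 0 < h) (h2 : h < 2) {y : ℝ}
    (hy : Omega h y = 2 * (1 - h / 2) ^ 2) : ∃ n : ℤ, y = h / 2 + h * n := by
  obtain ⟨N, h0, h1⟩ := exists_int_mul_sub_mem hh y
  have key := two_terms_le_Omega hh y N h0 h1
  rw [hy] at key
  refine ⟨N - 1, ?_⟩
  set τ := h * N - y with hτ
  have m1 := le_max_right 0 (1 - τ)
  have m2 := le_max_right 0 (1 - (h - τ))
  set u := max 0 (1 - τ)
  set v := max 0 (1 - (h - τ))
  have hs : 2 - h ≤ u + v := by linarith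
  have huv : (u - v) ^ 2 ≤ 0 := by nlinarith
  have huv' : u = v := by nlinarith
  have hu : u ≤ 1 - h / 2 := by
    rw [← huv'] at key
    exact le_of_sq_le_sq (by linarith) (by linarith)
  push_cast
  linarith

theorem Omega_half_eq {h : ℝ} (h2 : 2 / 3 ≤ h) (h1 : h ≤ 1) (n : ℤ) :
    Omega h (h / 2 + h * n) = 2 * (1 - h / 2) ^ 2 := by
  have hh : 0 < h := by linarith
  rw [Omega, tsum_eq_sum (s := {n, n + 1})]
  · rw [Finset.sum_pair (by omega)]
    push_cast
    rw [show h * n - (h / 2 + h * n) = -(h / 2) by ring,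
      show h * (n + 1) - (h / 2 + h * n) = h / 2 by ring, abs_neg, abs_of_pos (by linarith),
      max_eq_right (by linarith)]
    ring
  · intro m hm
    simp only [Finset.mem_insert, Finset.mem_singleton, not_or] at hm
    have : 1 - |h * (m : ℝ) - (h / 2 + h * n)| ≤ 0 := by
      rcases lt_or_gt_of_ne hm.1 with hlt | hgt
      · have : (m : ℝ) ≤ n - 1 := by exact_mod_cast Int.le_sub_one_of_lt hlt
        have := neg_abs_le (h * (m : ℝ) - (h / 2 + h * n))
        nlinarith
      · have : (n : ℝ) + 2 ≤ m := by
          have : n + 2 ≤ m := by omega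
          exact_mod_cast this
        have := le_abs_self (h * (m : ℝ) - (h / 2 + h * n))
        nlinarith
    rw [max_eq_left this]
    norm_num

/-- A lower bound for the sum of the squares of the numbers `v, v - h, v - 2 * h, …` down to the
last nonnegative one. -/
theorem le_sum_sq_sub {h v : ℝ} (hh : 0 < h) (hv : 0 ≤ v) :
    (v + h) ^ 3 / (3 * h) - (v + h) ^ 2 / 2 + h * (v + h) / 6 - h ^ 2 / 60 ≤
      ∑ k ∈ Finset.range (⌊v / h⌋₊ + 1), (v - k * h) ^ 2 := by
  have tel : ∀ m : ℕ, ∑ k ∈ Finset.range m, (v - k * h) ^ 2 =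
      ((v + h) ^ 3 / (3 * h) - (v + h) ^ 2 / 2 + h * (v + h) / 6) -
      ((v + h - m * h) ^ 3 / (3 * h) - (v + h - m * h) ^ 2 / 2 + h * (v + h - m * h) / 6) := by
    intro m
    induction m with
    | zero => simp
    | succ m ih =>
      rw [Finset.sum_range_succ, ih]
      push_cast
      field_simp
      ring
  rw [tel]
  have f1 : (⌊v / h⌋₊ : ℝ) * h ≤ v := by
    rw [← le_div_iff₀ hh]
    exact Nat.floor_le (div_nonneg hv hh.le)
  have f2 : v < ((⌊v / h⌋₊ : ℝ) + 1) * h := by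
    rw [← div_lt_iff₀ hh]
    exact Nat.lt_floor_add_one _
  set r := v + h - ((⌊v / h⌋₊ + 1 : ℕ) : ℝ) * h with hr
  push_cast at hr
  have r0 : 0 ≤ r := by linarith
  have rh : r ≤ h := by linarith
  have : r ^ 3 / (3 * h) - r ^ 2 / 2 + h * r / 6 ≤ h ^ 2 / 60 := by
    obtain ⟨u, hu⟩ : ∃ u, r = u * h := ⟨r / h, (div_mul_cancel₀ _ hh.ne').symm⟩
    have u0 : 0 ≤ u := by
      by_contra hc
      nlinarith
    have e : r ^ 3 / (3 * h) - r ^ 2 / 2 + h * r / 6 = h ^ 2 * (u ^ 3 / 3 - u ^ 2 / 2 + u / 6) := by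
      rw [hu]
      field_simp
    have u1 : u ≤ 1 := by
      by_contra hc
      nlinarith
    have : u ^ 3 / 3 - u ^ 2 / 2 + u / 6 ≤ 1 / 60 := by
      nlinarith [mul_nonneg u0 (sq_nonneg (u - 21 / 100)),
        mul_nonneg (sub_nonneg.2 u1) (sq_nonneg (u - 21 / 100)), sq_nonneg (u - 21 / 100)]
    rw [e]
    nlinarith [sq_nonneg h]
  linarith

theorem le_Omega_of_le_one {h : ℝ} (hh : 0 < h) (hh1 : h ≤ 1) (y : ℝ) (N : ℤ)
    (h0 : 0 ≤ h * N - y) (h1 : h * N - y ≤ h) :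
    2 / (3 * h) + h / 3 - 2 * (h * N - y) * (h - (h * N - y)) / h - h ^ 2 / 30 ≤ Omega h y := by
  set τ := h * N - y with hτ
  have R := le_sum_sq_sub hh (by linarith : 0 ≤ 1 - τ)
  have L := le_sum_sq_sub hh (by linarith : 0 ≤ 1 - (h - τ))
  set m := ⌊(1 - τ) / h⌋₊ + 1
  set m' := ⌊(1 - (h - τ)) / h⌋₊ + 1
  let iR : ℕ ↪ ℤ := ⟨fun k => N + k, fun a b hab => by simpa using hab⟩
  let iL : ℕ ↪ ℤ := ⟨fun k => N - 1 - k, fun a b hab => by simpa using hab⟩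
  have disj : Disjoint ((Finset.range m).map iR) ((Finset.range m').map iL) := by
    rw [Finset.disjoint_left]
    intro a ha hb
    obtain ⟨k, -, hk⟩ := Finset.mem_map.1 ha
    obtain ⟨l, -, hl⟩ := Finset.mem_map.1 hb
    change N + (k : ℤ) = a at hk
    change N - 1 - (l : ℤ) = a at hl
    omega
  have main := sum_le_Omega hh y ((Finset.range m).map iR ∪ (Finset.range m').map iL)
  rw [Finset.sum_union disj, Finset.sum_map, Finset.sum_map] at main
  have sq_le : ∀ (v : ℝ) (k : ℕ), 0 ≤ v → k ∈ Finset.range (⌊v / h⌋₊ + 1) → 0 ≤ v - k * h := by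
    intro v k hv hk
    have hk' : k ≤ ⌊v / h⌋₊ := Nat.lt_succ_iff.1 (Finset.mem_range.1 hk)
    have : (k : ℝ) ≤ v / h := (Nat.le_floor_iff (div_nonneg hv hh.le)).1 hk'
    rw [le_div_iff₀ hh] at this
    linarith
  have R' : ∑ k ∈ Finset.range m, (1 - τ - k * h) ^ 2 ≤
      ∑ k ∈ Finset.range m, max 0 (1 - |h * ((iR k : ℤ) : ℝ) - y|) ^ 2 := by
    refine Finset.sum_le_sum fun k hk => ?_
    have p := sq_le _ k (by linarith : 0 ≤ 1 - τ) hk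
    have e : h * ((iR k : ℤ) : ℝ) - y = τ + k * h := by
      change h * ((N + (k : ℤ) : ℤ) : ℝ) - y = _
      push_cast
      rw [hτ]
      ring
    rw [e, abs_of_nonneg (by positivity)]
    refine pow_le_pow_left₀ p (le_trans (le_of_eq ?_) (le_max_right _ _)) 2
    ring
  have L' : ∑ k ∈ Finset.range m', (1 - (h - τ) - k * h) ^ 2 ≤
      ∑ k ∈ Finset.range m', max 0 (1 - |h * ((iL k : ℤ) : ℝ) - y|) ^ 2 := by
    refine Finset.sum_le_sum fun k hk => ?_
    have p := sq_le _ k (by linarith : 0 ≤ 1 - (h - τ)) hk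
    have e : h * ((iL k : ℤ) : ℝ) - y = -((h - τ) + k * h) := by
      change h * ((N - 1 - (k : ℤ) : ℤ) : ℝ) - y = _
      push_cast
      rw [hτ]
      ring
    have q : 0 ≤ h - τ := by linarith
    rw [e, abs_neg, abs_of_nonneg (by positivity)]
    refine pow_le_pow_left₀ p (le_trans (le_of_eq ?_) (le_max_right _ _)) 2
    ring
  refine le_trans (le_of_eq ?_) (le_trans (add_le_add (R.trans R') (L.trans L')) main)
  field_simp
  ring

theorem le_Omega_zero {h : ℝ} (hh : 0 < h) (h1 : h ≤ 1) :
    2 / (3 * h) + h / 3 - h ^ 2 / 30 ≤ Omega h 0 := by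
  simpa using le_Omega_of_le_one hh h1 0 0 (by simp) (by simpa using hh.le)

theorem le_Omega {h : ℝ} (hh : 0 < h) (h1 : h ≤ 1) (y : ℝ) :
    2 / (3 * h) - h / 6 - h ^ 2 / 30 ≤ Omega h y := by
  obtain ⟨N, n0, n1⟩ := exists_int_mul_sub_mem hh y
  refine le_trans ?_ (le_Omega_of_le_one hh h1 y N n0 n1)
  have : 2 * (h * N - y) * (h - (h * N - y)) / h ≤ h / 2 := by
    rw [div_le_iff₀ hh]
    nlinarith [sq_nonneg (2 * (h * N - y) - h)]
  linarith

/-! ### Lower bounds for the factors -/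

/-- The value of `Omega (1 / x) 0` for `1 ≤ x ≤ 2`. -/
noncomputable def peak (x : ℝ) : ℝ := (3 * x ^ 2 - 4 * x + 2) / x ^ 2

/-- The minimum of `Omega (1 / x)` for `1 / 2 ≤ x ≤ 3 / 2`. -/
noncomputable def valley (x : ℝ) : ℝ := (2 * x - 1) ^ 2 / (2 * x ^ 2)

/-- A lower bound for `Omega (1 / x) 0`. -/
noncomputable def peakBound (x : ℝ) : ℝ :=
  if x < 1 then 1 else if x ≤ 13 / 10 then peak x else 2 * x / 3 + 1 / (3 * x) - 1 / (30 * x ^ 2)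

/-- A lower bound for all the values of `Omega (1 / x)`. -/
noncomputable def valleyBound (x : ℝ) : ℝ :=
  if x < 5 / 8 then 0 else if x ≤ 13 / 10 then valley x
    else 2 * x / 3 - 1 / (6 * x) - 1 / (30 * x ^ 2)

theorem peak_eq {x : ℝ} (hx : 0 < x) : peak x = 1 + 2 * (1 - 1 / x) ^ 2 := by
  rw [peak]
  field_simp
  ring

theorem valley_eq {x : ℝ} (hx : 0 < x) : valley x = 2 * (1 - 1 / x / 2) ^ 2 := by
  rw [valley]
  field_simp

theorem peakBound_le_Omega {x : ℝ} (hx : 0 < x) : peakBound x ≤ Omega (1 / x) 0 := by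
  have hh : 0 < 1 / x := by positivity
  rw [peakBound]
  split_ifs with h1 h2
  · exact one_le_Omega_zero hh
  · rw [peak_eq hx]
    exact one_sub_sq_le_Omega_zero hh (by rw [div_le_one hx]; linarith)
  · refine le_trans (le_of_eq ?_) (le_Omega_zero hh (by rw [div_le_one hx]; linarith))
    field_simp

theorem valleyBound_le_Omega {x : ℝ} (hx : 0 < x) (y : ℝ) : valleyBound x ≤ Omega (1 / x) y := by
  have hh : 0 < 1 / x := by positivity
  rw [valleyBound]
  split_ifs with h1 h2
  · exact Omega_nonneg _ _
  · rw [valley_eq hx]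
    exact le_Omega_of_le_two hh (by rw [div_le_iff₀ hx]; linarith) y
  · refine le_trans (le_of_eq ?_) (le_Omega hh (by rw [div_le_one hx]; linarith) y)
    field_simp

theorem peakBound_eq {x : ℝ} (h1 : 1 ≤ x) (h2 : x ≤ 13 / 10) : peakBound x = peak x := by
  rw [peakBound, if_neg (not_lt.2 h1), if_pos h2]

theorem valleyBound_eq {x : ℝ} (h1 : 5 / 8 ≤ x) (h2 : x ≤ 13 / 10) :
    valleyBound x = valley x := by
  rw [valleyBound, if_neg (not_lt.2 h1), if_pos h2]

theorem one_le_peak {x : ℝ} (hx : 0 < x) : 1 ≤ peak x := by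
  rw [peak_eq hx]
  nlinarith [sq_nonneg (1 - 1 / x)]

theorem valley_pos {x : ℝ} (h1 : 1 ≤ x) : 0 < valley x := by
  have : 0 < 2 * x - 1 := by linarith
  rw [valley]
  positivity

theorem valley_le_one {x : ℝ} (h1 : 1 ≤ x) (h2 : x ≤ 13 / 10) : valley x ≤ 1 := by
  rw [valley, div_le_one (by positivity)]
  nlinarith

theorem large_bounds {x : ℝ} (hx : 13 / 10 < x) :
    103 / 200 * (2 / 3 * (x - 1)) ≤ 2 * x / 3 + 1 / (3 * x) - 1 / (30 * x ^ 2) - 1 ∧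
    2 / 3 * (x - 1) ≤ 2 * x / 3 - 1 / (6 * x) - 1 / (30 * x ^ 2) - 1 / 2 := by
  have h0 : 0 < x := by linarith
  constructor
  · rw [← sub_nonneg]
    have : 2 * x / 3 + 1 / (3 * x) - 1 / (30 * x ^ 2) - 1 - 103 / 200 * (2 / 3 * (x - 1)) =
      (97 / 300 * x ^ 3 - 197 / 300 * x ^ 2 + x / 3 - 1 / 30) / x ^ 2 := by
      field_simp
      ring
    rw [this]
    refine div_nonneg ?_ (by positivity)
    nlinarith [mul_pos (sub_pos.2 hx) (sub_pos.2 hx),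
      mul_pos (mul_pos (sub_pos.2 hx) (sub_pos.2 hx)) (sub_pos.2 hx)]
  · have : 1 / (6 * x) + 1 / (30 * x ^ 2) ≤ 1 / 6 := by
      rw [div_add_div _ _ (by positivity) (by positivity),
        div_le_div_iff₀ (by positivity) (by norm_num)]
      nlinarith [mul_pos (sub_pos.2 hx) (sub_pos.2 hx),
        mul_pos (mul_pos (sub_pos.2 hx) (sub_pos.2 hx)) (sub_pos.2 hx)]
    linarith

theorem peakBound_pos {x : ℝ} (hx : 0 < x) : 0 < peakBound x := by
  rw [peakBound]
  split_ifs with h1 h2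
  · norm_num
  · linarith [one_le_peak hx]
  · linarith [(large_bounds (not_le.1 h2)).1]

theorem valleyBound_nonneg (x : ℝ) : 0 ≤ valleyBound x := by
  rw [valleyBound]
  split_ifs with h1 h2
  · exact le_rfl
  · rw [valley]
    positivity
  · linarith [(large_bounds (not_le.1 h2)).2]

theorem valleyBound_pos {x : ℝ} (hx : 1 ≤ x) : 0 < valleyBound x := by
  rw [valleyBound, if_neg (by linarith)]
  split_ifs with h2
  · exact valley_pos hx
  · linarith [(large_bounds (not_le.1 h2)).2]

theorem valleyBound_le {x : ℝ} (hx : 0 < x) : valleyBound x ≤ 2 * x / 3 := by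
  rw [valleyBound]
  split_ifs with h1 h2
  · positivity
  · rw [valley, div_le_iff₀ (by positivity)]
    have : 0 ≤ (x - 1) ^ 3 + 1 / 4 := by
      nlinarith [mul_nonneg (sub_nonneg.2 (not_lt.1 h1)) (sq_nonneg (x - 1)),
        sq_nonneg (x - 5 / 8)]
    nlinarith
  · have : 0 < 1 / (6 * x) := by positivity
    have : 0 < 1 / (30 * x ^ 2) := by positivity
    linarith

theorem sq_le_peakBound_mul_valleyBound {x : ℝ} (hx : 1 ≤ x) :
    (2 * x / 3) ^ 2 ≤ peakBound x * valleyBound x := by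
  rw [peakBound, if_neg (not_lt.2 hx), valleyBound, if_neg (show ¬ x < 5 / 8 by linarith)]
  have h0 : 0 < x := by linarith
  split_ifs with h2
  · rw [peak, valley, div_mul_div_comm, le_div_iff₀ (by positivity)]
    obtain ⟨s, rfl⟩ : ∃ s, x = 1 + s := ⟨x - 1, by ring⟩
    have s0 : 0 ≤ s := by linarith
    have s1 : s ≤ 3 / 10 := by linarith
    have : 0 ≤ 9 * (1 + 2 * s + 3 * s ^ 2) * (1 + 2 * s) ^ 2 - 8 * (1 + s) ^ 6 := by
      have e : 9 * (1 + 2 * s + 3 * s ^ 2) * (1 + 2 * s) ^ 2 - 8 * (1 + s) ^ 6 =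
        1 + 6 * s + 15 * s ^ 2 + 20 * s ^ 3 - 12 * s ^ 4 - 48 * s ^ 5 - 8 * s ^ 6 := by ring
      rw [e]
      have a : s ^ 4 ≤ s ^ 3 := pow_le_pow_of_le_one s0 (by linarith) (by norm_num)
      have b : s ^ 5 ≤ s ^ 3 * (9 / 100) := by
        have : s ^ 2 ≤ 9 / 100 := by nlinarith
        nlinarith [pow_nonneg s0 3]
      have c : s ^ 6 ≤ s ^ 5 := pow_le_pow_of_le_one s0 (by linarith) (by norm_num)
      nlinarith [pow_nonneg s0 3, pow_nonneg s0 2]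
    nlinarith
  · obtain ⟨h, rfl⟩ : ∃ h, x = 1 / h := ⟨1 / x, by simp⟩
    have hh : 0 < h := by simpa using h0
    have h1 : h ≤ 1 := by
      rwa [le_div_iff₀ hh, one_mul] at hx
    have e : (2 * (1 / h) / 3 + 1 / (3 * (1 / h)) - 1 / (30 * (1 / h) ^ 2)) *
        (2 * (1 / h) / 3 - 1 / (6 * (1 / h)) - 1 / (30 * (1 / h) ^ 2)) - (2 * (1 / h) / 3) ^ 2 =
        1 / 9 - 2 * h / 45 - h ^ 2 / 18 - h ^ 3 / 180 + h ^ 4 / 900 := by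
      field_simp
      ring
    rw [← sub_nonneg, e]
    nlinarith [pow_nonneg hh.le 4, pow_le_one₀ hh.le h1 (n := 2), pow_le_one₀ hh.le h1 (n := 3)]

/-! ### Reduction to the range `[1, 13 / 10]` -/

/-- A lower bound for `Lam e x y`, uniform in `y`. -/
noncomputable def LamBound {e : ℕ} (x : Fin e → ℝ) : ℝ :=
  -2 * ∏ j, (2 * x j / 3) + 2 * ∏ j, peakBound (x j) + ∏ j, valleyBound (x j)

theorem LamBound_le_Lam {e : ℕ} {x : Fin e → ℝ} (hx : ∀ j, 0 < x j) (y : Fin e → ℝ) :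
    LamBound x ≤ Lam e x y := by
  have e1 : (2 : ℝ) ^ (e + 1) / 3 ^ e * ∏ j, x j = 2 * ∏ j, (2 * x j / 3) := by
    simp_rw [mul_div_right_comm]
    rw [Finset.prod_mul_distrib, Finset.prod_const, Finset.card_univ, Fintype.card_fin, div_pow]
    ring
  have e2 : ∏ j, peakBound (x j) ≤ ∏ j, Omega (1 / x j) 0 :=
    Finset.prod_le_prod (fun j _ => (peakBound_pos (hx j)).le) fun j _ => peakBound_le_Omega (hx j)
  have e3 : ∏ j, valleyBound (x j) ≤ ∏ j, Omega (1 / x j) (1 + 2 * y j / x j) :=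
    Finset.prod_le_prod (fun j _ => valleyBound_nonneg _) fun j _ => valleyBound_le_Omega (hx j) _
  rw [LamBound, Lam]
  linarith

theorem prod_update_apply {ι : Type*} [Fintype ι] [DecidableEq ι] (f : ℝ → ℝ) (x : ι → ℝ) (i : ι)
    (t : ℝ) : ∏ j, f (Function.update x i t j) = f t * ∏ j ∈ Finset.univ.erase i, f (x j) := by
  rw [← Finset.mul_prod_erase _ _ (Finset.mem_univ i), Function.update_self]
  congr 1
  refine Finset.prod_congr rfl fun j hj => ?_
  rw [Function.update_of_ne (Finset.ne_of_mem_erase hj)]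

theorem LamBound_update {e : ℕ} (x : Fin e → ℝ) (i : Fin e) (t : ℝ) :
    LamBound (Function.update x i t) =
      -2 * (2 * t / 3 * ∏ j ∈ Finset.univ.erase i, (2 * x j / 3)) +
      2 * (peakBound t * ∏ j ∈ Finset.univ.erase i, peakBound (x j)) +
      valleyBound t * ∏ j ∈ Finset.univ.erase i, valleyBound (x j) := by
  rw [LamBound, prod_update_apply (fun s => 2 * s / 3), prod_update_apply peakBound,
    prod_update_apply valleyBound]

theorem peakBound_one : peakBound 1 = 1 := by
  rw [peakBound_eq le_rfl (by norm_num), peak]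
  norm_num

theorem valleyBound_one : valleyBound 1 = 1 / 2 := by
  rw [valleyBound_eq (by norm_num) (by norm_num), valley]
  norm_num

theorem half_sub_valleyBound_lt {x : ℝ} (hx : x < 1) :
    1 / 2 - valleyBound x < 4 / 3 * (1 - x) := by
  rw [valleyBound]
  split_ifs with h1 h2
  · linarith
  · have h0 : 0 < x := by linarith
    rw [sub_lt_comm, valley, lt_div_iff₀ (by positivity)]
    have : 0 < (1 - x) * (8 * x ^ 2 - 9 * x + 3) :=
      mul_pos (by linarith) (by nlinarith [sq_nonneg (16 * x - 9)])
    nlinarith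
  · linarith

theorem LamBound_update_one_lt_of_lt_one {e : ℕ} {x : Fin e → ℝ} (hx : ∀ j, 0 < x j) {i : Fin e}
    (hi : x i < 1) : LamBound (Function.update x i 1) < LamBound x := by
  have e1 := LamBound_update x i (x i)
  rw [Function.update_eq_self] at e1
  rw [LamBound_update, e1, peakBound_one, valleyBound_one,
    show peakBound (x i) = 1 by rw [peakBound, if_pos hi]]
  have hC : 0 < ∏ j ∈ Finset.univ.erase i, (2 * x j / 3) :=
    Finset.prod_pos fun j _ => by have := hx j; positivity
  have hQ : 0 ≤ ∏ j ∈ Finset.univ.erase i, valleyBound (x j) :=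
    Finset.prod_nonneg fun j _ => valleyBound_nonneg _
  have hQC : ∏ j ∈ Finset.univ.erase i, valleyBound (x j) ≤
      ∏ j ∈ Finset.univ.erase i, (2 * x j / 3) :=
    Finset.prod_le_prod (fun j _ => valleyBound_nonneg _) fun j _ => valleyBound_le (hx j)
  have hv := half_sub_valleyBound_lt hi
  generalize ∏ j ∈ Finset.univ.erase i, (2 * x j / 3) = C at *
  generalize ∏ j ∈ Finset.univ.erase i, valleyBound (x j) = Q at *
  have k1 : Q * (1 / 2 - valleyBound (x i)) ≤ Q * (4 / 3 * (1 - x i)) :=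
    mul_le_mul_of_nonneg_left hv.le hQ
  have k2 : Q * (4 / 3 * (1 - x i)) ≤ C * (4 / 3 * (1 - x i)) :=
    mul_le_mul_of_nonneg_right hQC (by linarith)
  rcases hQC.lt_or_eq with h | h
  · have : Q * (4 / 3 * (1 - x i)) < C * (4 / 3 * (1 - x i)) :=
      mul_lt_mul_of_pos_right h (by linarith)
    linarith
  · have : Q * (1 / 2 - valleyBound (x i)) < Q * (4 / 3 * (1 - x i)) :=
      mul_lt_mul_of_pos_left hv (h ▸ hC)
    linarith

theorem LamBound_update_one_lt_of_lt {e : ℕ} {x : Fin e → ℝ} (hx : ∀ j, 1 ≤ x j) {i : Fin e}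
    (hi : 13 / 10 < x i) : LamBound (Function.update x i 1) < LamBound x := by
  have e1 := LamBound_update x i (x i)
  rw [Function.update_eq_self] at e1
  rw [LamBound_update, e1, peakBound_one, valleyBound_one]
  have hx0 : ∀ j, 0 < x j := fun j => by linarith [hx j]
  have hC : 0 < ∏ j ∈ Finset.univ.erase i, (2 * x j / 3) :=
    Finset.prod_pos fun j _ => by have := hx0 j; positivity
  have hP : 0 < ∏ j ∈ Finset.univ.erase i, peakBound (x j) :=
    Finset.prod_pos fun j _ => peakBound_pos (hx0 j)
  have hQ : 0 < ∏ j ∈ Finset.univ.erase i, valleyBound (x j) :=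
    Finset.prod_pos fun j _ => valleyBound_pos (hx j)
  have hPQ : (∏ j ∈ Finset.univ.erase i, (2 * x j / 3)) ^ 2 ≤
      (∏ j ∈ Finset.univ.erase i, peakBound (x j)) *
        ∏ j ∈ Finset.univ.erase i, valleyBound (x j) := by
    rw [← Finset.prod_pow, ← Finset.prod_mul_distrib]
    exact Finset.prod_le_prod (fun j _ => sq_nonneg _)
      fun j _ => sq_le_peakBound_mul_valleyBound (hx j)
  generalize ∏ j ∈ Finset.univ.erase i, (2 * x j / 3) = C at *
  generalize ∏ j ∈ Finset.univ.erase i, valleyBound (x j) = Q at *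
  generalize ∏ j ∈ Finset.univ.erase i, peakBound (x j) = P at *
  obtain ⟨d2, d3⟩ := large_bounds hi
  have pe : peakBound (x i) = 2 * x i / 3 + 1 / (3 * x i) - 1 / (30 * x i ^ 2) := by
    rw [peakBound, if_neg (by linarith), if_neg (by linarith)]
  have ve : valleyBound (x i) = 2 * x i / 3 - 1 / (6 * x i) - 1 / (30 * x i ^ 2) := by
    rw [valleyBound, if_neg (by linarith), if_neg (by linarith)]
  rw [← pe] at d2
  rw [← ve] at d3
  set d := 2 / 3 * (x i - 1) with hd
  have d0 : 0 < d := by rw [hd]; linarith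
  have key : 2 * C < 2 * (103 / 200) * P + Q := by
    refine lt_of_pow_lt_pow_left₀ 2 (by positivity) ?_
    nlinarith [sq_nonneg (2 * (103 / 200) * P - Q), mul_pos hP hQ]
  have k1 := mul_le_mul_of_nonneg_left d2 hP.le
  have k2 := mul_le_mul_of_nonneg_left d3 hQ.le
  have k3 := mul_lt_mul_of_pos_left key d0
  nlinarith

/-! ### The range `[1, 13 / 10]` -/

theorem lt_of_hasDerivAt_sign {f f' : ℝ → ℝ} {l r g x : ℝ} (hg : g ∈ Set.Icc l r)
    (hd : ∀ x ∈ Set.Icc l r, HasDerivAt f (f' x) x) (hneg : ∀ x ∈ Set.Icc l r, x < g → f' x < 0)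
    (hpos : ∀ x ∈ Set.Icc l r, g < x → 0 < f' x) (hx : x ∈ Set.Icc l r) (hne : x ≠ g) :
    f g < f x := by
  rcases lt_or_gt_of_ne hne with h | h
  · have hsub : Set.Icc l g ⊆ Set.Icc l r := Set.Icc_subset_Icc_right hg.2
    refine strictAntiOn_of_deriv_neg (convex_Icc l g)
      (fun z hz => (hd z (hsub hz)).continuousAt.continuousWithinAt) (fun z hz => ?_)
      ⟨hx.1, h.le⟩ ⟨hg.1, le_rfl⟩ h
    rw [interior_Icc] at hz
    have hz' := hsub (Set.Ioo_subset_Icc_self hz)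
    rw [(hd z hz').deriv]
    exact hneg z hz' hz.2
  · have hsub : Set.Icc g r ⊆ Set.Icc l r := Set.Icc_subset_Icc_left hg.1
    refine strictMonoOn_of_deriv_pos (convex_Icc g r)
      (fun z hz => (hd z (hsub hz)).continuousAt.continuousWithinAt) (fun z hz => ?_)
      ⟨le_rfl, hg.2⟩ ⟨h.le, hx.2⟩ h
    rw [interior_Icc] at hz
    have hz' := hsub (Set.Ioo_subset_Icc_self hz)
    rw [(hd z hz').deriv]
    exact hpos z hz' hz.1

theorem hasDerivAt_peak {x : ℝ} (hx : 0 < x) : HasDerivAt peak (4 * (x - 1) / x ^ 3) x := by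
  have h1 : HasDerivAt (fun x : ℝ => 3 * x ^ 2 - 4 * x + 2) (6 * x - 4) x := by
    have := (((hasDerivAt_pow 2 x).const_mul 3).sub ((hasDerivAt_id x).const_mul 4)).add_const 2
    exact this.congr_deriv (by norm_num; ring)
  have := h1.div (hasDerivAt_pow 2 x) (by positivity)
  refine this.congr_deriv ?_
  field_simp
  ring

theorem hasDerivAt_valley {x : ℝ} (hx : 0 < x) :
    HasDerivAt valley ((2 * x - 1) / x ^ 3) x := by
  have h1 : HasDerivAt (fun x : ℝ => (2 * x - 1) ^ 2) (4 * (2 * x - 1)) x := by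
    have := (((hasDerivAt_id x).const_mul 2).sub_const 1).pow 2
    exact this.congr_deriv (by norm_num; ring)
  have := h1.div ((hasDerivAt_pow 2 x).const_mul 2) (by positivity)
  refine this.congr_deriv ?_
  field_simp
  ring

theorem quad_pos (x : ℝ) : 0 < 3 * x ^ 2 - 4 * x + 2 := by
  nlinarith [sq_nonneg (3 * x - 2)]

/-- The logarithmic derivative (with respect to `log x`) of `peak ^ p * valley ^ q` is
increasing. -/
theorem logDeriv_lt {p q x y : ℝ} (hq : 0 < q) (hpq : 2 * q ≤ p) (hx : 1 ≤ x) (hxy : x < y)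
    (hy : y ≤ 13 / 10) :
    p * (4 * (x - 1) / (3 * x ^ 2 - 4 * x + 2)) + q * (2 / (2 * x - 1)) <
      p * (4 * (y - 1) / (3 * y ^ 2 - 4 * y + 2)) + q * (2 / (2 * y - 1)) := by
  obtain ⟨s, rfl⟩ : ∃ s, x = 1 + s := ⟨x - 1, by ring⟩
  obtain ⟨t, rfl⟩ : ∃ t, y = 1 + t := ⟨y - 1, by ring⟩
  have s0 : 0 ≤ s := by linarith
  have st : s < t := by linarith
  have t0 : 0 < t := by linarith
  have t1 : t ≤ 3 / 10 := by linarith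
  have Ds : 0 < 1 + 2 * s + 3 * s ^ 2 := by positivity
  have Dt : 0 < 1 + 2 * t + 3 * t ^ 2 := by positivity
  have As : 0 < 1 + 2 * s := by linarith
  have At : 0 < 1 + 2 * t := by linarith
  have b1 : 1 + 2 * s + 3 * s ^ 2 ≤ 117 / 100 * (1 + 2 * s) := by nlinarith
  have b2 : 1 + 2 * t + 3 * t ^ 2 ≤ 117 / 100 * (1 + 2 * t) := by nlinarith
  have b3 : (1 + 2 * s + 3 * s ^ 2) * (1 + 2 * t + 3 * t ^ 2) ≤
      (117 / 100) ^ 2 * ((1 + 2 * s) * (1 + 2 * t)) :=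
    (mul_le_mul b1 b2 Dt.le (by positivity)).trans (le_of_eq (by ring))
  have b4 : (73 : ℝ) / 100 ≤ 1 - 3 * s * t := by nlinarith
  have AA := mul_pos As At
  have DD := mul_pos Ds Dt
  have b5 : (1 + 2 * s + 3 * s ^ 2) * (1 + 2 * t + 3 * t ^ 2) <
      2 * (1 - 3 * s * t) * ((1 + 2 * s) * (1 + 2 * t)) := by nlinarith
  have b6 : 1 / ((1 + 2 * s) * (1 + 2 * t)) <
      2 * (1 - 3 * s * t) / ((1 + 2 * s + 3 * s ^ 2) * (1 + 2 * t + 3 * t ^ 2)) := by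
    rw [div_lt_div_iff₀ AA DD]
    linarith
  have e1 : 4 * (1 + t - 1) / (3 * (1 + t) ^ 2 - 4 * (1 + t) + 2) -
      4 * (1 + s - 1) / (3 * (1 + s) ^ 2 - 4 * (1 + s) + 2) =
      2 * (t - s) * (2 * (1 - 3 * s * t) /
        ((1 + 2 * s + 3 * s ^ 2) * (1 + 2 * t + 3 * t ^ 2))) := by
    rw [show 3 * (1 + t) ^ 2 - 4 * (1 + t) + 2 = 1 + 2 * t + 3 * t ^ 2 by ring,
      show 3 * (1 + s) ^ 2 - 4 * (1 + s) + 2 = 1 + 2 * s + 3 * s ^ 2 by ring]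
    field_simp
    ring
  have e2 : 2 / (2 * (1 + s) - 1) - 2 / (2 * (1 + t) - 1) =
      4 * (t - s) * (1 / ((1 + 2 * s) * (1 + 2 * t))) := by
    rw [show 2 * (1 + t) - 1 = 1 + 2 * t by ring, show 2 * (1 + s) - 1 = 1 + 2 * s by ring]
    field_simp
    ring
  have pos : 0 < 1 / ((1 + 2 * s) * (1 + 2 * t)) := by positivity
  have c1 : q * (4 * (t - s) * (1 / ((1 + 2 * s) * (1 + 2 * t)))) <
      q * (4 * (t - s) * (2 * (1 - 3 * s * t) /
        ((1 + 2 * s + 3 * s ^ 2) * (1 + 2 * t + 3 * t ^ 2)))) :=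
    mul_lt_mul_of_pos_left (mul_lt_mul_of_pos_left b6 (by linarith)) hq
  have c2 : 2 * q * (2 * (t - s) * (2 * (1 - 3 * s * t) /
        ((1 + 2 * s + 3 * s ^ 2) * (1 + 2 * t + 3 * t ^ 2)))) ≤
      p * (2 * (t - s) * (2 * (1 - 3 * s * t) /
        ((1 + 2 * s + 3 * s ^ 2) * (1 + 2 * t + 3 * t ^ 2)))) :=
    mul_le_mul_of_nonneg_right hpq
      (mul_nonneg (by linarith) (div_nonneg (by linarith) DD.le))
  have e3 := congrArg (p * ·) e1
  have e4 := congrArg (q * ·) e2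
  linarith

/-- The value of `LamBound` at a constant tuple with entry in `[1, 13 / 10]`. -/
noncomputable def diag (e : ℕ) (x : ℝ) : ℝ := -2 * (2 * x / 3) ^ e + 2 * peak x ^ e + valley x ^ e

theorem exists_tangent {p q g : ℝ} (hq : 0 < q) (hpq : 2 * q ≤ p)
    (hg : g ∈ Set.Icc (1 : ℝ) (13 / 10)) : ∃ k : ℝ, ∀ x ∈ Set.Icc (1 : ℝ) (13 / 10), x ≠ g →
      k * (Real.log x - Real.log g) <
        p * (Real.log (peak x) - Real.log (peak g)) +
          q * (Real.log (valley x) - Real.log (valley g)) := by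
  let S : ℝ → ℝ := fun x => p * (4 * (x - 1) / (3 * x ^ 2 - 4 * x + 2)) + q * (2 / (2 * x - 1))
  refine ⟨S g, fun x hx hne => ?_⟩
  have hd : ∀ x ∈ Set.Icc (1 : ℝ) (13 / 10), HasDerivAt
      (fun x => p * Real.log (peak x) + q * Real.log (valley x) - S g * Real.log x)
      ((S x - S g) / x) x := by
    intro x hx
    have x0 : 0 < x := by linarith [hx.1]
    have v0 : 2 * x - 1 ≠ 0 := by linarith [hx.1]
    have D0 := (quad_pos x).ne'
    have := (((((hasDerivAt_peak x0).log (by linarith [one_le_peak x0])).const_mul p).add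
      (((hasDerivAt_valley x0).log (valley_pos hx.1).ne').const_mul q)).sub
      ((Real.hasDerivAt_log x0.ne').const_mul (S g)))
    refine this.congr_deriv ?_
    simp only [S, peak, valley]
    field_simp
  have := lt_of_hasDerivAt_sign hg hd
    (fun z hz hzg => div_neg_of_neg_of_pos (sub_neg.2 (logDeriv_lt hq hpq hz.1 hzg hg.2))
      (by linarith [hz.1]))
    (fun z hz hzg => div_pos (sub_pos.2 (logDeriv_lt hq hpq hg.1 hzg hz.2)) (by linarith [hz.1]))
    hx hne
  linarith

theorem pow_mul_one_add_sum_log_le {e : ℕ} {a : Fin e → ℝ} {c : ℝ} (ha : ∀ j, 0 < a j)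
    (hc : 0 < c) :
    c ^ e * (1 + ∑ j, (Real.log (a j) - Real.log c)) ≤ ∏ j, a j := by
  have e1 : ∏ j, a j = c ^ e * Real.exp (∑ j, (Real.log (a j) - Real.log c)) := by
    rw [Real.exp_sum]
    have : ∀ j, Real.exp (Real.log (a j) - Real.log c) = a j / c := fun j => by
      rw [Real.exp_sub, Real.exp_log (ha j), Real.exp_log hc]
    simp_rw [this]
    rw [Finset.prod_div_distrib, Finset.prod_const, Finset.card_univ, Fintype.card_fin]
    field_simp
  rw [e1]
  refine mul_le_mul_of_nonneg_left ?_ (by positivity)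
  rw [add_comm]
  exact Real.add_one_le_exp _

/-- Replacing all coordinates by their geometric mean decreases `LamBound`. -/
theorem exists_diag_le_LamBound {e : ℕ} (he : 1 ≤ e) {x : Fin e → ℝ}
    (hx : ∀ j, x j ∈ Set.Icc (1 : ℝ) (13 / 10)) :
    ∃ g ∈ Set.Icc (1 : ℝ) (13 / 10), diag e g ≤ LamBound x ∧
      (LamBound x ≤ diag e g → ∀ j, x j = g) := by
  have x0 : ∀ j, 0 < x j := fun j => by linarith [(hx j).1]
  have e0 : (0 : ℝ) < e := by exact_mod_cast he
  set L := ∑ j, Real.log (x j) with hL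
  set g := Real.exp (L / e) with hgdef
  have g0 : 0 < g := Real.exp_pos _
  have lg : Real.log g = L / e := Real.log_exp _
  have hsum : ∑ j, (Real.log (x j) - Real.log g) = 0 := by
    rw [Finset.sum_sub_distrib, Finset.sum_const, Finset.card_univ, Fintype.card_fin, lg,
      nsmul_eq_mul, mul_div_cancel₀ _ e0.ne', sub_self]
  have hprod : ∏ j, x j = g ^ e := by
    rw [← Real.exp_nat_mul, mul_div_cancel₀ _ e0.ne', Real.exp_sum]
    exact Finset.prod_congr rfl fun j _ => (Real.exp_log (x0 j)).symm
  have hg : g ∈ Set.Icc (1 : ℝ) (13 / 10) := by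
    constructor
    · refine Real.one_le_exp (div_nonneg (Finset.sum_nonneg fun j _ => ?_) e0.le)
      exact Real.log_nonneg (hx j).1
    · rw [← Real.log_le_log_iff g0 (by norm_num), lg, div_le_iff₀ e0]
      have : L ≤ ∑ _j : Fin e, Real.log (13 / 10) :=
        Finset.sum_le_sum fun j _ => Real.log_le_log (x0 j) (hx j).2
      rw [Finset.sum_const, Finset.card_univ, Fintype.card_fin, nsmul_eq_mul] at this
      linarith
  have hv := valley_pos hg.1
  have hp := one_le_peak g0
  have hq : 0 < valley g ^ e := by positivity
  have hpq : 2 * valley g ^ e ≤ 2 * peak g ^ e := by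
    have : valley g ^ e ≤ peak g ^ e :=
      pow_le_pow_left₀ hv.le ((valley_le_one hg.1 hg.2).trans hp) e
    linarith
  obtain ⟨k, hk⟩ := exists_tangent hq hpq hg
  have P := pow_mul_one_add_sum_log_le (fun j => by linarith [one_le_peak (x0 j)] :
    ∀ j, 0 < peak (x j)) (by linarith : 0 < peak g)
  have Q := pow_mul_one_add_sum_log_le (fun j => valley_pos (hx j).1) hv
  have hLB : LamBound x = -2 * (2 * g / 3) ^ e + 2 * ∏ j, peak (x j) + ∏ j, valley (x j) := by
    rw [LamBound, Finset.prod_congr rfl fun j _ => peakBound_eq (hx j).1 (hx j).2,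
      Finset.prod_congr rfl fun j _ => valleyBound_eq (by linarith [(hx j).1]) (hx j).2]
    simp_rw [mul_div_right_comm]
    rw [Finset.prod_mul_distrib, Finset.prod_const, Finset.card_univ, Fintype.card_fin, hprod,
      mul_pow]
  let T : Fin e → ℝ := fun j => 2 * peak g ^ e * (Real.log (peak (x j)) - Real.log (peak g)) +
    valley g ^ e * (Real.log (valley (x j)) - Real.log (valley g)) -
      k * (Real.log (x j) - Real.log g)
  have hT : ∑ j, T j = 2 * peak g ^ e * ∑ j, (Real.log (peak (x j)) - Real.log (peak g)) +
      valley g ^ e * ∑ j, (Real.log (valley (x j)) - Real.log (valley g)) := by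
    simp only [T]
    rw [Finset.sum_sub_distrib, Finset.sum_add_distrib, ← Finset.mul_sum, ← Finset.mul_sum,
      ← Finset.mul_sum, hsum]
    ring
  have hTle : diag e g + ∑ j, T j ≤ LamBound x := by
    rw [hLB, hT, diag]
    linarith
  have T0 : ∀ j, 0 ≤ T j := by
    intro j
    by_cases h : x j = g
    · simp [T, h]
    · have := hk (x j) (hx j) h
      simp only [T]
      linarith
  refine ⟨g, hg, ?_, fun hle j => ?_⟩
  · linarith [Finset.sum_nonneg fun j (_ : j ∈ Finset.univ) => T0 j]
  · by_contra hne
    have t1 : 0 < T j := by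
      have := hk (x j) (hx j) hne
      simp only [T]
      linarith
    have := Finset.sum_pos' (fun j (_ : j ∈ Finset.univ) => T0 j) ⟨j, Finset.mem_univ j, t1⟩
    linarith

/-! ### The diagonal -/

/-- The polynomial defining the minimizer for `e = k + 1`, divided by `(3 x² - 4 x + 2) ^ k`. -/
noncomputable def critRatio (k : ℕ) (x : ℝ) : ℝ :=
  x ^ 3 * (x ^ 3 / (3 * x ^ 2 - 4 * x + 2)) ^ k - 4 * (3 / 2) ^ (k + 1) * (x - 1) -
    (3 / 4) ^ (k + 1) * (2 * x - 1) * ((2 * x - 1) ^ 2 / (3 * x ^ 2 - 4 * x + 2)) ^ k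

theorem critPoly_eq (k : ℕ) (x : ℝ) :
    x ^ (3 * (k + 1)) - (3 : ℝ) ^ (k + 1) / (2 : ℝ) ^ (((k + 1 : ℕ) : ℤ) - 2) * (x - 1) *
          (3 * x ^ 2 - 4 * x + 2) ^ (k + 1 - 1) -
        (3 : ℝ) ^ (k + 1) / 2 ^ (2 * (k + 1)) * (2 * x - 1) ^ (2 * (k + 1) - 1) =
      (3 * x ^ 2 - 4 * x + 2) ^ k * critRatio k x := by
  have D0 := quad_pos x
  rw [critRatio, zpow_sub₀ (by norm_num), zpow_natCast, Nat.add_sub_cancel,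
    show 2 * (k + 1) - 1 = 2 * k + 1 by omega]
  generalize hD : 3 * x ^ 2 - 4 * x + 2 = D at *
  have e1 : D ^ k * (x ^ 3 / D) ^ k = x ^ (3 * k) := by
    rw [← mul_pow, mul_div_cancel₀ _ D0.ne', pow_mul]
  have e2 : D ^ k * ((2 * x - 1) ^ 2 / D) ^ k = (2 * x - 1) ^ (2 * k) := by
    rw [← mul_pow, mul_div_cancel₀ _ D0.ne', pow_mul]
  have e3 : (3 : ℝ) ^ (k + 1) / (2 ^ (k + 1) / 2 ^ (2 : ℤ)) = 4 * (3 / 2) ^ (k + 1) := by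
    rw [div_pow]
    norm_num
    field_simp
  have e4 : (3 : ℝ) ^ (k + 1) / 2 ^ (2 * (k + 1)) = (3 / 4) ^ (k + 1) := by
    rw [pow_mul, div_pow]
    norm_num
  rw [e3, e4, mul_add, pow_add, ← e1, pow_succ (2 * x - 1), ← e2]
  ring

theorem hasDerivAt_diag (k : ℕ) {x : ℝ} (hx : 0 < x) :
    HasDerivAt (diag (k + 1))
      (-((k + 1) * (2 / x ^ 3) * (2 / 3) ^ (k + 1) * peak x ^ k * critRatio k x)) x := by
  have D0 := quad_pos x
  have h1 : HasDerivAt (fun x : ℝ => 2 * x / 3) (2 / 3) x :=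
    (((hasDerivAt_id x).const_mul 2).div_const 3).congr_deriv (by norm_num)
  have := (((h1.pow (k + 1)).const_mul (-2)).add
    (((hasDerivAt_peak hx).pow (k + 1)).const_mul 2)).add ((hasDerivAt_valley hx).pow (k + 1))
  refine this.congr_deriv ?_
  have p1 : peak x ^ k * (x ^ 3 / (3 * x ^ 2 - 4 * x + 2)) ^ k = x ^ k := by
    rw [← mul_pow, peak]
    generalize 3 * x ^ 2 - 4 * x + 2 = D at D0 ⊢
    congr 1
    field_simp
  have p2 : peak x ^ k * ((2 * x - 1) ^ 2 / (3 * x ^ 2 - 4 * x + 2)) ^ k =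
      2 ^ k * valley x ^ k := by
    rw [← mul_pow, ← mul_pow, peak, valley]
    generalize 3 * x ^ 2 - 4 * x + 2 = D at D0 ⊢
    congr 1
    field_simp
  have p3 : ((2 : ℝ) / 3) ^ (k + 1) * (3 / 2) ^ (k + 1) = 1 := by
    rw [← mul_pow]
    norm_num
  have p4 : ((2 : ℝ) / 3) ^ (k + 1) * (3 / 4) ^ (k + 1) * 2 ^ k = 1 / 2 := by
    rw [← mul_pow, pow_succ, mul_right_comm, ← mul_pow]
    norm_num
  have p5 : (2 * x / 3) ^ k * (2 / 3) = (2 / 3) ^ (k + 1) * x ^ k := by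
    rw [mul_div_right_comm, mul_pow]
    ring
  have expand : (k + 1) * (2 / x ^ 3) * (2 / 3) ^ (k + 1) * peak x ^ k * critRatio k x =
      (k + 1) * (2 / x ^ 3) * (x ^ 3 * ((2 / 3) ^ (k + 1) *
        (peak x ^ k * (x ^ 3 / (3 * x ^ 2 - 4 * x + 2)) ^ k)) -
        4 * (((2 : ℝ) / 3) ^ (k + 1) * (3 / 2) ^ (k + 1)) * (x - 1) * peak x ^ k -
        (2 / 3) ^ (k + 1) * (3 / 4) ^ (k + 1) * (2 * x - 1) * (peak x ^ k *
          ((2 * x - 1) ^ 2 / (3 * x ^ 2 - 4 * x + 2)) ^ k)) := by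
    rw [critRatio]
    ring
  rw [expand, p1, p2, p3, ← p5]
  have p6 : ((2 : ℝ) / 3) ^ (k + 1) * (3 / 4) ^ (k + 1) * (2 * x - 1) * (2 ^ k * valley x ^ k) =
      1 / 2 * (2 * x - 1) * valley x ^ k := by
    rw [← p4]
    ring
  rw [p6, Nat.add_sub_cancel]
  push_cast
  field_simp
  ring

theorem cube_div_quad_mem {x : ℝ} (hx : x ∈ Set.Icc (1 : ℝ) (13 / 10)) :
    1 ≤ x ^ 3 / (3 * x ^ 2 - 4 * x + 2) ∧ x ^ 3 / (3 * x ^ 2 - 4 * x + 2) ≤ 6 / 5 ∧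
      x ^ 3 / (3 * x ^ 2 - 4 * x + 2) ≤ x := by
  obtain ⟨h1, h2⟩ := hx
  rw [le_div_iff₀ (quad_pos x), div_le_iff₀ (quad_pos x), div_le_iff₀ (quad_pos x)]
  obtain ⟨s, rfl⟩ : ∃ s, x = 1 + s := ⟨x - 1, by ring⟩
  have s0 : 0 ≤ s := by linarith
  have s1 : s ≤ 3 / 10 := by linarith
  have s3 := pow_nonneg s0 3
  have s2 := pow_nonneg s0 2
  have s3' : s ^ 3 ≤ 3 / 10 * s ^ 2 := by nlinarith
  refine ⟨by nlinarith, by nlinarith [sq_nonneg (s - 3 / 10)], by nlinarith⟩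

theorem add_three_mul_pow_lt (k : ℕ) :
    169 / 100 * ((k : ℝ) + 3) * (6 / 5) ^ k < 4 * (3 / 2) ^ (k + 1) := by
  rcases k with _ | k
  · norm_num
  · induction k with
    | zero => norm_num
    | succ k ih =>
      have p1 : (0 : ℝ) < (6 / 5) ^ (k + 1) := by positivity
      have kk : (0 : ℝ) ≤ k := Nat.cast_nonneg k
      rw [pow_succ (6 / 5 : ℝ), pow_succ (3 / 2 : ℝ)]
      push_cast at ih ⊢
      nlinarith [mul_nonneg kk p1.le]

theorem critRatio_strictAntiOn (k : ℕ) : StrictAntiOn (critRatio k) (Set.Icc 1 (13 / 10)) := by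
  have hd : ∀ x : ℝ, HasDerivAt
      (fun x : ℝ => x ^ 3 * (x ^ 3 / (3 * x ^ 2 - 4 * x + 2)) ^ k - 4 * (3 / 2) ^ (k + 1) * (x - 1))
      (3 * x ^ 2 * (x ^ 3 / (3 * x ^ 2 - 4 * x + 2)) ^ k +
        k * (x ^ 3 / (3 * x ^ 2 - 4 * x + 2)) ^ (k - 1) *
          (x ^ 5 * (3 * x ^ 2 - 8 * x + 6) / (3 * x ^ 2 - 4 * x + 2) ^ 2) -
        4 * (3 / 2) ^ (k + 1)) x := by
    intro x
    have D0 := quad_pos x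
    have h1 : HasDerivAt (fun x : ℝ => 3 * x ^ 2 - 4 * x + 2) (6 * x - 4) x := by
      have := (((hasDerivAt_pow 2 x).const_mul 3).sub ((hasDerivAt_id x).const_mul 4)).add_const 2
      exact this.congr_deriv (by norm_num; ring)
    have h2 := ((hasDerivAt_pow 3 x).mul (((hasDerivAt_pow 3 x).div h1 D0.ne').pow k)).sub
      (((hasDerivAt_id x).sub_const 1).const_mul (4 * (3 / 2) ^ (k + 1)))
    refine h2.congr_deriv ?_
    simp only [Pi.div_apply, Pi.pow_apply]
    generalize hE : (x ^ 3 / (3 * x ^ 2 - 4 * x + 2)) ^ (k - 1) = E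
    generalize hF : (x ^ 3 / (3 * x ^ 2 - 4 * x + 2)) ^ k = F
    push_cast
    field_simp
    ring
  have anti : StrictAntiOn (fun x : ℝ => x ^ 3 * (x ^ 3 / (3 * x ^ 2 - 4 * x + 2)) ^ k -
      4 * (3 / 2) ^ (k + 1) * (x - 1)) (Set.Icc 1 (13 / 10)) := by
    refine strictAntiOn_of_deriv_neg (convex_Icc _ _)
      (fun z _ => (hd z).continuousAt.continuousWithinAt) fun x hx => ?_
    rw [interior_Icc] at hx
    have hx' := Set.Ioo_subset_Icc_self hx
    rw [(hd x).deriv]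
    obtain ⟨w1, w2, -⟩ := cube_div_quad_mem hx'
    have D0 := quad_pos x
    have b1 : (x ^ 3 / (3 * x ^ 2 - 4 * x + 2)) ^ k ≤ (6 / 5) ^ k :=
      pow_le_pow_left₀ (by linarith) w2 k
    have b2 : (x ^ 3 / (3 * x ^ 2 - 4 * x + 2)) ^ (k - 1) ≤ (6 / 5) ^ k :=
      (pow_le_pow_right₀ w1 (Nat.sub_le k 1)).trans b1
    have b3 : x ^ 5 * (3 * x ^ 2 - 8 * x + 6) / (3 * x ^ 2 - 4 * x + 2) ^ 2 ≤ 169 / 100 := by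
      rw [div_le_iff₀ (by positivity)]
      obtain ⟨s, rfl⟩ : ∃ s, x = 1 + s := ⟨x - 1, by ring⟩
      have s0 : 0 ≤ s := by linarith [hx'.1]
      have s1 : s ≤ 3 / 10 := by linarith [hx'.2]
      have c1 : (1 + s) ^ 2 ≤ 169 / 100 := by nlinarith
      have c2 : (1 + s) ^ 3 * (1 - 2 * s + 3 * s ^ 2) ≤ (1 + 2 * s + 3 * s ^ 2) ^ 2 := by
        have e : (1 + 2 * s + 3 * s ^ 2) ^ 2 - (1 + s) ^ 3 * (1 - 2 * s + 3 * s ^ 2) =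
          s * (3 + 10 * s + (8 * s ^ 2 + 2 * s ^ 3 - 3 * s ^ 4)) := by ring
        have : 0 ≤ 8 * s ^ 2 + 2 * s ^ 3 - 3 * s ^ 4 := by
          have : 0 ≤ s ^ 2 * (8 + 2 * s - 3 * s ^ 2) :=
            mul_nonneg (sq_nonneg s) (by nlinarith)
          linarith
        have : 0 ≤ s * (3 + 10 * s + (8 * s ^ 2 + 2 * s ^ 3 - 3 * s ^ 4)) :=
          mul_nonneg s0 (by linarith)
        linarith
      calc (1 + s) ^ 5 * (3 * (1 + s) ^ 2 - 8 * (1 + s) + 6)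
          = (1 + s) ^ 2 * ((1 + s) ^ 3 * (1 - 2 * s + 3 * s ^ 2)) := by ring
        _ ≤ 169 / 100 * (1 + 2 * s + 3 * s ^ 2) ^ 2 := mul_le_mul c1 c2
            (mul_nonneg (by positivity) (by nlinarith [sq_nonneg (3 * s - 1)])) (by norm_num)
        _ = _ := by ring
    have b4 : x ^ 2 ≤ 169 / 100 := by nlinarith [hx'.1, hx'.2]
    have kk : (0 : ℝ) ≤ k := Nat.cast_nonneg k
    have c1 : 3 * x ^ 2 * (x ^ 3 / (3 * x ^ 2 - 4 * x + 2)) ^ k ≤ 3 * (169 / 100) * (6 / 5) ^ k :=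
      mul_le_mul (by linarith) b1 (pow_nonneg (by linarith) _) (by norm_num)
    have c2 : k * (x ^ 3 / (3 * x ^ 2 - 4 * x + 2)) ^ (k - 1) *
        (x ^ 5 * (3 * x ^ 2 - 8 * x + 6) / (3 * x ^ 2 - 4 * x + 2) ^ 2) ≤
        k * (6 / 5) ^ k * (169 / 100) := by
      refine mul_le_mul (mul_le_mul_of_nonneg_left b2 kk) b3 (div_nonneg (mul_nonneg ?_ ?_) ?_)
        (by positivity)
      · exact pow_nonneg (by linarith [hx'.1]) _
      · nlinarith [sq_nonneg (3 * x - 4)]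
      · positivity
    have := add_three_mul_pow_lt k
    linarith
  intro x hx y hy hxy
  have h1 := anti hx hy hxy
  simp only at h1
  have hle : (2 * x - 1) ^ 2 / (3 * x ^ 2 - 4 * x + 2) ≤
      (2 * y - 1) ^ 2 / (3 * y ^ 2 - 4 * y + 2) := by
    rw [div_le_div_iff₀ (quad_pos x) (quad_pos y)]
    obtain ⟨s, rfl⟩ : ∃ s, x = 1 + s := ⟨x - 1, by ring⟩
    obtain ⟨d, rfl⟩ : ∃ d, y = 1 + s + d := ⟨y - (1 + s), by ring⟩
    have s0 : 0 ≤ s := by linarith [hx.1]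
    have d0 : 0 < d := by linarith
    rw [← sub_nonneg]
    have e : (2 * (1 + s + d) - 1) ^ 2 * (3 * (1 + s) ^ 2 - 4 * (1 + s) + 2) -
        (2 * (1 + s) - 1) ^ 2 * (3 * (1 + s + d) ^ 2 - 4 * (1 + s + d) + 2) =
        d * (2 + 2 * s + d - 4 * s ^ 2 - 4 * s * d) := by ring
    rw [e]
    have sd : s + d ≤ 3 / 10 := by linarith [hy.2]
    exact mul_nonneg d0.le (by nlinarith [mul_nonneg s0 (sub_nonneg.2 sd)])
  have h2 : (3 / 4) ^ (k + 1) * (2 * x - 1) * ((2 * x - 1) ^ 2 / (3 * x ^ 2 - 4 * x + 2)) ^ k ≤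
      (3 / 4) ^ (k + 1) * (2 * y - 1) * ((2 * y - 1) ^ 2 / (3 * y ^ 2 - 4 * y + 2)) ^ k := by
    have hp : (0 : ℝ) ≤ (3 / 4) ^ (k + 1) := by positivity
    have q0 : 0 ≤ (2 * x - 1) ^ 2 / (3 * x ^ 2 - 4 * x + 2) :=
      div_nonneg (sq_nonneg _) (quad_pos x).le
    exact mul_le_mul (mul_le_mul_of_nonneg_left (by linarith) hp) (pow_le_pow_left₀ q0 hle k)
      (pow_nonneg q0 k) (mul_nonneg hp (by linarith [hy.1]))
  rw [critRatio, critRatio]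
  linarith

theorem critRatio_one_pos (k : ℕ) : 0 < critRatio k 1 := by
  have : ((3 : ℝ) / 4) ^ (k + 1) < 1 := pow_lt_one₀ (by norm_num) (by norm_num) (by omega)
  rw [critRatio]
  norm_num
  exact this

theorem continuous_critRatio (k : ℕ) : Continuous (critRatio k) := by
  unfold critRatio
  have : ∀ x : ℝ, 3 * x ^ 2 - 4 * x + 2 ≠ 0 := fun x => (quad_pos x).ne'
  fun_prop (disch := assumption)

theorem endpoint_eq (k : ℕ) :
    (1 : ℝ) + 3 ^ (k + 1 + 1) / 2 ^ (2 * (k + 1) + 3) = 1 + 3 / 8 * (3 / 4) ^ (k + 1) := by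
  rw [pow_add 2, pow_mul, pow_succ 3, div_pow]
  norm_num
  ring

theorem endpoint_le (k : ℕ) : 1 + 3 / 8 * ((3 : ℝ) / 4) ^ (k + 1) ≤ 13 / 10 := by
  have : ((3 : ℝ) / 4) ^ (k + 1) ≤ (3 / 4) ^ 1 :=
    pow_le_pow_of_le_one (by norm_num) (by norm_num) (by omega)
  linarith

theorem endpoint_pow_lt {k : ℕ} (hk : 2 ≤ k) :
    (1 + 3 / 8 * ((3 : ℝ) / 4) ^ (k + 1)) ^ (k + 3) < 3 / 2 * (9 / 8) ^ (k + 1) := by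
  obtain rfl | hk3 := hk.eq_or_lt
  · norm_num
  have h1 : (k + 3) * (3 / 8 * ((3 : ℝ) / 4) ^ (k + 1)) ≤ 3 / 4 := by
    induction k, hk3 using Nat.le_induction with
    | base => norm_num
    | succ k hk ih =>
      have ih := ih (by omega)
      have kk : (0 : ℝ) ≤ k := Nat.cast_nonneg k
      have p : (0 : ℝ) < (3 / 4) ^ (k + 1) := by positivity
      rw [pow_succ _ (k + 1)]
      push_cast
      nlinarith [mul_nonneg kk p.le]
  have h2 : (1 + 3 / 8 * ((3 : ℝ) / 4) ^ (k + 1)) ^ (k + 3) ≤ Real.exp (3 / 4) := by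
    have h := Real.add_one_le_exp (3 / 8 * ((3 : ℝ) / 4) ^ (k + 1))
    rw [add_comm] at h
    refine (pow_le_pow_left₀ (by positivity) h _).trans ?_
    rw [← Real.exp_nat_mul]
    refine Real.exp_le_exp.2 (le_trans (le_of_eq ?_) h1)
    push_cast
    ring
  have h3 : Real.exp (3 / 4) < 3 / 2 * (9 / 8) ^ 4 := by
    refine lt_of_pow_lt_pow_left₀ 4 (by norm_num) ?_
    rw [← Real.exp_nat_mul, show ((4 : ℕ) : ℝ) * (3 / 4) = (3 : ℕ) * 1 by norm_num,
      Real.exp_nat_mul]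
    refine (pow_lt_pow_left₀ Real.exp_one_lt_d9 (Real.exp_pos _).le (by norm_num)).trans ?_
    norm_num
  have h4 : ((9 : ℝ) / 8) ^ 4 ≤ (9 / 8) ^ (k + 1) := pow_le_pow_right₀ (by norm_num) (by omega)
  linarith

theorem critRatio_endpoint_neg (k : ℕ) :
    critRatio k (1 + 3 / 8 * ((3 : ℝ) / 4) ^ (k + 1)) < 0 := by
  rcases lt_or_ge k 2 with hk | hk
  · interval_cases k <;> norm_num [critRatio]
  have hlt := endpoint_pow_lt hk
  have hle := endpoint_le k
  have hp : 0 < ((3 : ℝ) / 4) ^ (k + 1) := by positivity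
  have e1 : 4 * (3 / 2) ^ (k + 1) * (1 + 3 / 8 * ((3 : ℝ) / 4) ^ (k + 1) - 1) =
      3 / 2 * (9 / 8) ^ (k + 1) := by
    rw [show (9 / 8 : ℝ) = 3 / 2 * (3 / 4) by norm_num, mul_pow]
    ring
  have h1 : 1 ≤ 1 + 3 / 8 * ((3 : ℝ) / 4) ^ (k + 1) := by linarith
  rw [critRatio, e1]
  generalize 1 + 3 / 8 * ((3 : ℝ) / 4) ^ (k + 1) = x at *
  have hx1 : x ∈ Set.Icc (1 : ℝ) (13 / 10) := ⟨h1, hle⟩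
  obtain ⟨w1, -, w2⟩ := cube_div_quad_mem hx1
  have a1 : x ^ 3 * (x ^ 3 / (3 * x ^ 2 - 4 * x + 2)) ^ k ≤ x ^ (k + 3) := by
    rw [add_comm k 3, pow_add]
    exact mul_le_mul_of_nonneg_left (pow_le_pow_left₀ (by linarith) w2 k)
      (pow_nonneg (by linarith) 3)
  have a2 : 0 ≤ (3 / 4) ^ (k + 1) * (2 * x - 1) *
      ((2 * x - 1) ^ 2 / (3 * x ^ 2 - 4 * x + 2)) ^ k :=
    mul_nonneg (mul_nonneg hp.le (by linarith [hx1.1]))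
      (pow_nonneg (div_nonneg (sq_nonneg _) (quad_pos x).le) k)
  linarith

/-! ### Conclusion -/

theorem min_of_update_one {e : ℕ} {F : (Fin e → ℝ) → ℝ} {S T : Set ℝ} {m : ℝ}
    {Q : (Fin e → ℝ) → Prop} (hTS : T ⊆ S) (h1 : 1 ∈ T)
    (hF : ∀ x : Fin e → ℝ, (∀ j, x j ∈ S) → ∀ i, x i ∉ T → F (Function.update x i 1) < F x)
    (hT : ∀ x : Fin e → ℝ, (∀ j, x j ∈ T) → m ≤ F x ∧ (F x ≤ m → Q x))
    {x : Fin e → ℝ} (hx : ∀ j, x j ∈ S) : m ≤ F x ∧ (F x ≤ m → Q x) := by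
  classical
  induction hs : (Finset.univ.filter fun j => x j ∉ T).card using Nat.strong_induction_on
    generalizing x with
  | _ s ih =>
    by_cases hall : ∀ j, x j ∈ T
    · exact hT x hall
    push Not at hall
    obtain ⟨i, hi⟩ := hall
    have hlt : (Finset.univ.filter fun j => Function.update x i 1 j ∉ T).card < s := by
      rw [← hs]
      refine Finset.card_lt_card ⟨fun j hj => ?_, fun h => ?_⟩
      · rw [Finset.mem_filter] at hj ⊢
        refine ⟨hj.1, ?_⟩
        rcases eq_or_ne j i with rfl | hji
        · exact hi
        · simpa [hji] using hj.2
      · have := h (Finset.mem_filter.2 ⟨Finset.mem_univ i, hi⟩)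
        simp [h1] at this
    have hmem : ∀ j, Function.update x i 1 j ∈ S := fun j => by
      rcases eq_or_ne j i with rfl | hji
      · simpa using hTS h1
      · simpa [hji] using hx j
    have hu := hF x hx i hi
    have := (ih _ hlt hmem rfl).1
    exact ⟨by linarith, fun h => by linarith⟩

theorem diag_le_LamBound {e : ℕ} (he : 1 ≤ e) {b : ℝ}
    (hb : ∀ x ∈ Set.Icc (1 : ℝ) (13 / 10), x ≠ b → diag e b < diag e x) {x : Fin e → ℝ}
    (hx : ∀ j, 0 < x j) : diag e b ≤ LamBound x ∧ (LamBound x ≤ diag e b → ∀ j, x j = b) := by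
  refine min_of_update_one (S := Set.Ioi 0) (T := Set.Ici 1) (Q := fun x => ∀ j, x j = b)
    (Set.Ici_subset_Ioi.2 one_pos) Set.self_mem_Ici
    (fun x hx i hi => LamBound_update_one_lt_of_lt_one hx (not_le.1 hi)) (fun x hx => ?_) hx
  refine min_of_update_one (S := Set.Ici 1) (T := Set.Icc 1 (13 / 10)) (Q := fun x => ∀ j, x j = b)
    Set.Icc_subset_Ici_self ⟨le_rfl, by norm_num⟩
    (fun x hx i hi => LamBound_update_one_lt_of_lt hx (not_le.1 fun h => hi ⟨hx i, h⟩))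
    (fun x hx => ?_) hx
  obtain ⟨g, hg, hle, heq⟩ := exists_diag_le_LamBound he hx
  rcases eq_or_ne g b with rfl | hgb
  · exact ⟨hle, heq⟩
  · have := hb g hg hgb
    exact ⟨by linarith, fun h => by linarith⟩

theorem Lam_diag {e : ℕ} {b : ℝ} (hb : b ∈ Set.Icc (1 : ℝ) (13 / 10)) {x y : Fin e → ℝ}
    (hx : ∀ j, x j = b) (hy : ∀ j, ∃ n : ℤ, y j = (1 - 2 * b) / 4 + (n : ℝ) / 2) :
    Lam e x y = diag e b := by
  obtain ⟨h1, h2⟩ := hb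
  have b0 : 0 < b := by linarith
  have i1 : 1 / b ≤ 1 := by rw [div_le_one b0]; exact h1
  have i2 : 2 / 3 ≤ 1 / b := by rw [le_div_iff₀ b0]; linarith
  have hO : ∀ j, Omega (1 / b) (1 + 2 * y j / b) = valley b := fun j => by
    obtain ⟨n, hn⟩ := hy j
    rw [valley_eq b0, ← Omega_half_eq i2 i1 n, hn]
    congr 1
    field_simp
    ring
  have hP : Omega (1 / b) 0 = peak b := by
    rw [peak_eq b0, Omega_zero_eq (by linarith) i1]
  simp only [Lam, hx, hO, hP, Finset.prod_const, Finset.card_univ, Fintype.card_fin, diag]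
  rw [mul_div_right_comm, mul_pow, div_pow]
  ring

theorem exists_of_Lam_le_diag {e : ℕ} {b : ℝ} (hb : b ∈ Set.Icc (1 : ℝ) (13 / 10))
    {x y : Fin e → ℝ} (hx : ∀ j, x j = b) (hle : Lam e x y ≤ diag e b) (j : Fin e) :
    ∃ n : ℤ, y j = (1 - 2 * b) / 4 + (n : ℝ) / 2 := by
  have b0 : 0 < b := by linarith [hb.1]
  have i1 : 1 / b ≤ 1 := by rw [div_le_one b0]; exact hb.1
  have i0 : 0 < 1 / b := by positivity
  have hOle : ∀ j, valley b ≤ Omega (1 / b) (1 + 2 * y j / b) := fun j => by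
    rw [valley_eq b0]
    exact le_Omega_of_le_two i0 (by linarith) _
  have hO : Omega (1 / b) (1 + 2 * y j / b) = valley b := by
    by_contra hne
    have hlt : ∏ _j : Fin e, valley b < ∏ j, Omega (1 / b) (1 + 2 * y j / b) :=
      Finset.prod_lt_prod (fun _ _ => valley_pos hb.1) (fun j _ => hOle j)
        ⟨j, Finset.mem_univ j, (hOle j).lt_of_ne' hne⟩
    have h1 := Lam_diag hb hx (y := fun _ => (1 - 2 * b) / 4) fun _ => ⟨0, by simp⟩
    have hv : ∀ y' : Fin e → ℝ, Lam e x y' = -((2 : ℝ) ^ (e + 1) / 3 ^ e) * ∏ _j : Fin e, b +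
        2 * ∏ _j : Fin e, Omega (1 / b) 0 + ∏ j, Omega (1 / b) (1 + 2 * y' j / b) := fun y' => by
      simp only [Lam, hx]
    have hw : Omega (1 / b) (1 + 2 * ((1 - 2 * b) / 4) / b) = valley b := by
      have i2 : 2 / 3 ≤ 1 / b := by rw [le_div_iff₀ b0]; linarith [hb.2]
      rw [valley_eq b0, ← Omega_half_eq i2 i1 0]
      congr 1
      push_cast
      field_simp
      ring
    rw [hv] at h1 hle
    simp only [hw] at h1
    linarith
  rw [valley_eq b0] at hO
  obtain ⟨n, hn⟩ := exists_of_Omega_eq i0 (by linarith) hO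
  refine ⟨n, ?_⟩
  field_simp at hn
  linarith

theorem diag_lt_of_critRatio_eq_zero {k : ℕ} {b : ℝ} (hb : b ∈ Set.Icc (1 : ℝ) (13 / 10))
    (hb0 : critRatio k b = 0) {x : ℝ} (hx : x ∈ Set.Icc (1 : ℝ) (13 / 10)) (hne : x ≠ b) :
    diag (k + 1) b < diag (k + 1) x := by
  have hc : ∀ x ∈ Set.Icc (1 : ℝ) (13 / 10),
      0 < (k + 1) * (2 / x ^ 3) * (2 / 3) ^ (k + 1) * peak x ^ k := fun x hx => by
    have x0 : 0 < x := by linarith [hx.1]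
    have := one_le_peak x0
    positivity
  refine lt_of_hasDerivAt_sign hb (fun x hx => hasDerivAt_diag k (by linarith [hx.1]))
    (fun x hx hlt => ?_) (fun x hx hlt => ?_) hx hne
  · have := critRatio_strictAntiOn k hx hb hlt
    exact neg_neg_of_pos (mul_pos (hc x hx) (by linarith))
  · have := critRatio_strictAntiOn k hb hx hlt
    exact neg_pos.2 (mul_neg_of_pos_of_neg (hc x hx) (by linarith))

/-- `Lam e` attains a global minimum (over `x_j > 0`, `y_j ∈ ℝ`), and
`(x, y)` is a global minimizer iff `x_1 = ⋯ = x_e = b_e` and each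
`y_j ∈ {(1-2b_e)/4 + n/2 : n ∈ ℤ}`, where `b_e` is the unique root in
`(1, 1 + 3^(e+1)/2^(2e+3))` of
`x^(3e) - (3^e/2^(e-2))(x-1)(3x²-4x+2)^(e-1) - (3^e/2^(2e))(2x-1)^(2e-1)`. -/
theorem stmt_6 (e : ℕ) (he : 1 ≤ e) :
    ∃ b : ℝ, b ∈ Set.Ioo (1 : ℝ) (1 + 3 ^ (e + 1) / 2 ^ (2 * e + 3)) ∧
      b ^ (3 * e) - (3 : ℝ) ^ e / (2 : ℝ) ^ ((e : ℤ) - 2) * (b - 1) *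
          (3 * b ^ 2 - 4 * b + 2) ^ (e - 1) -
        (3 : ℝ) ^ e / 2 ^ (2 * e) * (2 * b - 1) ^ (2 * e - 1) = 0 ∧
      (∀ x ∈ Set.Ioo (1 : ℝ) (1 + 3 ^ (e + 1) / 2 ^ (2 * e + 3)),
        x ^ (3 * e) - (3 : ℝ) ^ e / (2 : ℝ) ^ ((e : ℤ) - 2) * (x - 1) *
            (3 * x ^ 2 - 4 * x + 2) ^ (e - 1) -
          (3 : ℝ) ^ e / 2 ^ (2 * e) * (2 * x - 1) ^ (2 * e - 1) = 0 → x = b) ∧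
      (∃ x y : Fin e → ℝ, (∀ j, 0 < x j) ∧
        ∀ x' y' : Fin e → ℝ, (∀ j, 0 < x' j) → Lam e x y ≤ Lam e x' y') ∧
      (∀ x y : Fin e → ℝ, (∀ j, 0 < x j) →
        ((∀ x' y' : Fin e → ℝ, (∀ j, 0 < x' j) → Lam e x y ≤ Lam e x' y') ↔
          (∀ j, x j = b) ∧ ∀ j, ∃ n : ℤ, y j = (1 - 2 * b) / 4 + (n : ℝ) / 2)) := by
  obtain ⟨k, rfl⟩ : ∃ k, e = k + 1 := ⟨e - 1, by omega⟩
  simp only [critPoly_eq, endpoint_eq]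
  have hsub : Set.Ioo 1 (1 + 3 / 8 * ((3 : ℝ) / 4) ^ (k + 1)) ⊆ Set.Icc 1 (13 / 10) :=
    fun x hx => ⟨hx.1.le, hx.2.le.trans (endpoint_le k)⟩
  have h1 : (1 : ℝ) ≤ 1 + 3 / 8 * ((3 : ℝ) / 4) ^ (k + 1) := by
    have : 0 < ((3 : ℝ) / 4) ^ (k + 1) := by positivity
    linarith
  obtain ⟨b, hb, hb0⟩ := intermediate_value_Ioo' h1 (continuous_critRatio k).continuousOn
    ⟨critRatio_endpoint_neg k, critRatio_one_pos k⟩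
  have hbI := hsub hb
  have hmin : ∀ x y : Fin (k + 1) → ℝ, (∀ j, 0 < x j) →
      diag (k + 1) b ≤ Lam (k + 1) x y ∧ (Lam (k + 1) x y ≤ diag (k + 1) b → ∀ j, x j = b) :=
    fun x y hx => by
      have hL := LamBound_le_Lam hx y
      obtain ⟨hle, heq⟩ := diag_le_LamBound he
        (fun x hx hne => diag_lt_of_critRatio_eq_zero hbI hb0 hx hne) hx
      exact ⟨hle.trans hL, fun h => heq (hL.trans h)⟩
  have hval : Lam (k + 1) (fun _ => b) (fun _ => (1 - 2 * b) / 4) = diag (k + 1) b :=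
    Lam_diag hbI (fun _ => rfl) fun _ => ⟨0, by simp⟩
  have b0 : 0 < b := by linarith [hb.1]
  refine ⟨b, hb, by rw [hb0, mul_zero], fun x hx hx0 => ?_, ?_, fun x y hx => ⟨fun h => ?_, ?_⟩⟩
  · have := (mul_eq_zero.1 hx0).resolve_left (pow_pos (quad_pos x) k).ne'
    exact (critRatio_strictAntiOn k).injOn (hsub hx) hbI (this.trans hb0.symm)
  · exact ⟨_, _, fun _ => b0, fun x' y' hx' => hval.le.trans (hmin x' y' hx').1⟩
  · have hle := (h _ _ fun _ => b0).trans_eq hval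
    have hxb := (hmin x y hx).2 hle
    exact ⟨hxb, exists_of_Lam_le_diag hbI hxb hle⟩
  · rintro ⟨hxb, hy⟩ x' y' hx'
    exact (Lam_diag hbI hxb hy).le.trans (hmin x' y' hx').1
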